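/- arXiv:2102.00519 — 3 statements merged into one kernel-verified Lean document; each statement's English description precedes it below -/
import Mathlib

section
/- For every d ≥ 2 and every positive integer V, the number of minimal d-dimensional V-boxes satisfies f_d(V) ≤ α^{d-2} · d! · (d-1)! · V^{(d-1)/d}, where α = ⌈√V⌉/√V ≤ √2. In particular, f_d(V) ≤ 2^{(d-2)/2} d!(d-1)! V^{(d-1)/d}. -/
/-- A `d`-dimensional box with side lengths `x` is a minimal `V`-box. -/
def IsMinBox (d V : ℕ) (x : Fin d → ℕ) : Prop :=
  (∀ i, 1 ≤ x i) ∧ V ≤ ∏ i, x i ∧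
  ∀ y : Fin d → ℕ, (∀ i, 1 ≤ y i) → (∀ i, y i ≤ x i) → y ≠ x → ∏ i, y i < V

/-- `f_d(V)`, the number of minimal `d`-dimensional `V`-boxes. -/
noncomputable def numMinBoxes (d V : ℕ) : ℕ :=
  Nat.card {x : Fin d → ℕ // IsMinBox d V x}

lemma IsMinBox.le {d V : ℕ} (hV : 1 ≤ V) {x : Fin d → ℕ} (hx : IsMinBox d V x) (i : Fin d) :
    x i ≤ V := by
  by_contra! h
  have hlt := hx.2.2 (Function.update x i V)
    (fun j ↦ by
      rcases eq_or_ne j i with rfl | hj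
      · simpa using hV
      · simpa [hj] using hx.1 j)
    (fun j ↦ by
      rcases eq_or_ne j i with rfl | hj
      · simpa using h.le
      · simp [hj])
    (fun he ↦ by
      have := congrFun he i
      simp at this
      omega)
  rw [Finset.prod_update_of_mem (Finset.mem_univ i)] at hlt
  have hpos : 1 ≤ ∏ j ∈ Finset.univ \ {i}, x j := Finset.one_le_prod' fun j _ ↦ hx.1 j
  nlinarith

lemma finite_setOf_isMinBox (d : ℕ) {V : ℕ} (hV : 1 ≤ V) : {x | IsMinBox d V x}.Finite :=
  (Set.finite_Iic fun _ : Fin d ↦ V).subset fun _ hx i ↦ IsMinBox.le hV hx i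

lemma IsMinBox.sub_one_mul_prod_lt {d V : ℕ} (hV : 1 ≤ V) {x : Fin (d + 1) → ℕ}
    (hx : IsMinBox (d + 1) V x) (i : Fin (d + 1)) :
    (x i - 1) * ∏ j, x (i.succAbove j) < V := by
  have hi := hx.1 i
  rcases hi.eq_or_lt with h1 | h1
  · rw [← h1]
    simpa using Nat.pos_of_ne_zero (by omega)
  have hlt := hx.2.2 (Function.update x i (x i - 1))
    (fun j ↦ by
      rcases eq_or_ne j i with rfl | hj
      · simp
        omega
      · simpa [hj] using hx.1 j)
    (fun j ↦ by
      rcases eq_or_ne j i with rfl | hj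
      · simp
      · simp [hj])
    (fun he ↦ by
      have := congrFun he i
      simp at this
      omega)
  rw [Fin.prod_univ_succAbove _ i] at hlt
  simpa using hlt

lemma IsMinBox.removeNth {d V : ℕ} {x : Fin (d + 1) → ℕ}
    (hx : IsMinBox (d + 1) V x) (i : Fin (d + 1)) :
    IsMinBox d (V ⌈/⌉ x i) (i.removeNth x) := by
  have hi : 0 < x i := hx.1 i
  refine ⟨fun j ↦ hx.1 _, ?_, fun y hy1 hyx hne ↦ ?_⟩
  · rw [ceilDiv_le_iff_le_mul hi]
    have := hx.2.1
    rwa [Fin.prod_univ_succAbove _ i] at this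
  · rw [← not_le, ceilDiv_le_iff_le_mul hi, not_le]
    have := hx.2.2 (i.insertNth (x i) y)
      (fun j ↦ by
        refine Fin.succAboveCases i ?_ (fun k ↦ ?_) j
        · simpa using hx.1 i
        · simpa using hy1 k)
      (fun j ↦ by
        refine Fin.succAboveCases i ?_ (fun k ↦ ?_) j
        · simp
        · simpa [Fin.removeNth] using hyx k)
      (fun he ↦ hne (by rw [← he]; simp))
    rw [Fin.prod_univ_succAbove _ i] at this
    simpa using this

lemma one_le_ceilDiv {V m : ℕ} (hV : 1 ≤ V) (hm : 1 ≤ m) : 1 ≤ V ⌈/⌉ m := by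
  rw [← not_lt, Nat.lt_one_iff, ← Nat.le_zero, ceilDiv_le_iff_le_mul hm]
  omega

lemma numMinBoxes_succ_le (d : ℕ) {V M : ℕ} (hV : 1 ≤ V)
    (hM : ∀ m, 1 ≤ m → (m - 1) * m ^ d < V → m ≤ M) :
    numMinBoxes (d + 1) V ≤ (d + 1) * ∑ m ∈ Finset.Icc 1 M, numMinBoxes d (V ⌈/⌉ m) := by
  classical
  have hcard (e W : ℕ) : numMinBoxes e W = {x | IsMinBox e W x}.ncard := rfl
  have hsub : {x | IsMinBox (d + 1) V x} ⊆
      ⋃ i ∈ (Finset.univ : Finset (Fin (d + 1))), ⋃ m ∈ Finset.Icc 1 M,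
        (fun y ↦ (i.insertNth m y : Fin (d + 1) → ℕ)) '' {y | IsMinBox d (V ⌈/⌉ m) y} := by
    intro x hx
    obtain ⟨i, hi⟩ := Finite.exists_min x
    simp only [Set.mem_iUnion]
    refine ⟨i, Finset.mem_univ i, x i, ?_, i.removeNth x, hx.removeNth i, by simp⟩
    refine Finset.mem_Icc.2 ⟨hx.1 i, hM _ (hx.1 i) ?_⟩
    refine lt_of_le_of_lt (Nat.mul_le_mul_left _ ?_) (hx.sub_one_mul_prod_lt hV i)
    calc x i ^ d = ∏ _j : Fin d, x i := by simp
      _ ≤ _ := Finset.prod_le_prod' fun j _ ↦ hi _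
  have hfin : ∀ i : Fin (d + 1), ∀ m ∈ Finset.Icc 1 M,
      ((fun y ↦ (i.insertNth m y : Fin (d + 1) → ℕ)) '' {y | IsMinBox d (V ⌈/⌉ m) y}).Finite :=
    fun i m hm ↦
      (finite_setOf_isMinBox d (one_le_ceilDiv hV (Finset.mem_Icc.1 hm).1)).image _
  rw [hcard]
  refine (Set.ncard_le_ncard hsub ?_).trans ?_
  · exact Set.Finite.biUnion (Finset.finite_toSet _) fun i _ ↦
      Set.Finite.biUnion (Finset.finite_toSet _) fun m hm ↦ hfin i m hm
  refine (Finset.set_ncard_biUnion_le _ _).trans ?_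
  calc _ ≤ ∑ _i : Fin (d + 1), ∑ m ∈ Finset.Icc 1 M, numMinBoxes d (V ⌈/⌉ m) := by
        refine Finset.sum_le_sum fun i _ ↦ (Finset.set_ncard_biUnion_le _ _).trans ?_
        refine Finset.sum_le_sum fun m hm ↦ ?_
        rw [hcard]
        exact Set.ncard_image_le
          (finite_setOf_isMinBox d (one_le_ceilDiv hV (Finset.mem_Icc.1 hm).1))
    _ = _ := by simp

lemma IsMinBox.eq_of_apply_eq {V : ℕ} {x y : Fin 2 → ℕ} (hx : IsMinBox 2 V x)
    (hy : IsMinBox 2 V y) (i : Fin 2) (h : x i = y i) : x = y := by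
  have key {u v : Fin 2 → ℕ} (hu : IsMinBox 2 V u) (hv : IsMinBox 2 V v) (h : u i = v i)
      (hle : ∀ j, j ≠ i → u j ≤ v j) : u = v := by
    by_contra hne
    refine absurd (hv.2.2 u hu.1 (fun j ↦ ?_) hne) (not_lt.2 hu.2.1)
    rcases eq_or_ne j i with rfl | hj
    · exact h.le
    · exact hle j hj
  have hother : (∀ j, j ≠ i → x j ≤ y j) ∨ ∀ j, j ≠ i → y j ≤ x j := by
    rcases le_total (x (i + 1)) (y (i + 1)) with hl | hl
    · left
      intro j hj
      rwa [show j = i + 1 by omega]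
    · right
      intro j hj
      rwa [show j = i + 1 by omega]
  rcases hother with hl | hl
  · exact key hx hy h hl
  · exact (key hy hx h.symm hl).symm

lemma numMinBoxes_two_le_add {V K L : ℕ} (hV : 1 ≤ V) (h : V ≤ (K + 1) * L) :
    numMinBoxes 2 V ≤ K + L := by
  have hsub : {x | IsMinBox 2 V x} ⊆
      {x | IsMinBox 2 V x ∧ x 0 ∈ Set.Icc 1 K} ∪ {x | IsMinBox 2 V x ∧ x 1 ∈ Set.Icc 1 L} := by
    intro x hx
    by_cases h0 : x 0 ≤ K
    · exact Or.inl ⟨hx, hx.1 0, h0⟩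
    refine Or.inr ⟨hx, hx.1 1, ?_⟩
    by_contra! h1
    have hlt := hx.sub_one_mul_prod_lt hV 1
    have h2 : (K + 1) * L ≤ (x 1 - 1) * x 0 := by
      rw [mul_comm]
      exact Nat.mul_le_mul (by omega) (by omega)
    simp [Fin.succAbove] at hlt
    omega
  have hcount (i : Fin 2) (B : ℕ) :
      {x | IsMinBox 2 V x ∧ x i ∈ Set.Icc 1 B}.ncard ≤ B := by
    calc _ ≤ (Set.Icc 1 B).ncard :=
          Set.ncard_le_ncard_of_injOn (fun x ↦ x i) (fun x hx ↦ hx.2)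
            (fun x hx y hy hxy ↦ hx.1.eq_of_apply_eq hy.1 i hxy) (Set.finite_Icc _ _)
      _ = B := by simp [Set.ncard_eq_toFinset_card']
  have hfin := finite_setOf_isMinBox 2 hV
  calc numMinBoxes 2 V = {x | IsMinBox 2 V x}.ncard := rfl
    _ ≤ _ := Set.ncard_le_ncard hsub
        ((hfin.subset fun x hx ↦ hx.1).union (hfin.subset fun x hx ↦ hx.1))
    _ ≤ _ := Set.ncard_union_le _ _
    _ ≤ K + L := add_le_add (hcount 0 K) (hcount 1 L)

lemma numMinBoxes_two_le {V : ℕ} (hV : 1 ≤ V) : (numMinBoxes 2 V : ℝ) ≤ 2 * √(V : ℝ) := by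
  have hn := Nat.sqrt_le V
  have hn' := Nat.lt_succ_sqrt V
  set n := V.sqrt
  have key : ∃ t : ℕ, numMinBoxes 2 V ≤ t ∧ t ^ 2 ≤ 4 * V := by
    by_cases h : V ≤ (n + 1) * n
    · exact ⟨n + n, numMinBoxes_two_le_add hV h, by nlinarith⟩
    · exact ⟨n + (n + 1), numMinBoxes_two_le_add hV hn'.le, by nlinarith⟩
  obtain ⟨t, ht, htV⟩ := key
  have htV' : (t : ℝ) ^ 2 ≤ 4 * V := by exact_mod_cast htV
  calc (numMinBoxes 2 V : ℝ) ≤ t := by exact_mod_cast ht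
    _ ≤ 2 * √(V : ℝ) := by
      refine abs_le_of_sq_le_sq' ?_ (by positivity) |>.2
      rw [mul_pow, Real.sq_sqrt (Nat.cast_nonneg V)]
      linarith

/-- Comparison of `∑ m ^ (p - 1)` with the integral of `t ^ (p - 1)` over `[1, N]`. -/
lemma mul_sum_Icc_rpow_sub_one_le {p : ℝ} (hp0 : 0 < p) (hp1 : p ≤ 1) {N : ℕ} (hN : 1 ≤ N) :
    p * ∑ m ∈ Finset.Icc 1 N, (m : ℝ) ^ (p - 1) ≤ (N : ℝ) ^ p - (1 - p) := by
  induction N, hN using Nat.le_induction with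
  | base => simp
  | succ N hN ih =>
    rw [Finset.sum_Icc_succ_top (by omega), mul_add]
    have hpos : (0 : ℝ) < (N + 1 : ℕ) := by positivity
    have hb : (1 + -1 / ((N + 1 : ℕ) : ℝ)) ^ p ≤ 1 + p * (-1 / ((N + 1 : ℕ) : ℝ)) := by
      refine rpow_one_add_le_one_add_mul_self ?_ hp0.le hp1
      rw [le_div_iff₀ hpos]
      push_cast
      linarith [(Nat.cast_nonneg N : (0 : ℝ) ≤ N)]
    have hfac : (N : ℝ) = ((N + 1 : ℕ) : ℝ) * (1 + -1 / ((N + 1 : ℕ) : ℝ)) := by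
      field_simp
      push_cast
      ring
    have hnn : 0 ≤ 1 + -1 / ((N + 1 : ℕ) : ℝ) := by
      by_contra! hneg
      have : (N : ℝ) < 0 := by rw [hfac]; exact mul_neg_of_pos_of_neg hpos hneg
      exact absurd this (not_lt.2 (Nat.cast_nonneg N))
    have hNp : (N : ℝ) ^ p ≤
        ((N + 1 : ℕ) : ℝ) ^ p * (1 + p * (-1 / ((N + 1 : ℕ) : ℝ))) := by
      conv_lhs => rw [hfac]
      rw [Real.mul_rpow hpos.le hnn]
      gcongr
    rw [Real.rpow_sub_one hpos.ne']
    have : ((N + 1 : ℕ) : ℝ) ^ p * (1 + p * (-1 / ((N + 1 : ℕ) : ℝ))) =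
        ((N + 1 : ℕ) : ℝ) ^ p - p * (((N + 1 : ℕ) : ℝ) ^ p / ((N + 1 : ℕ) : ℝ)) := by ring
    linarith

lemma natCast_ceilDiv_rpow_le {V m : ℕ} (hV : 1 ≤ V) (hm : 1 ≤ m) {s : ℝ} (hs0 : 0 ≤ s)
    (hs1 : s ≤ 1) :
    ((V ⌈/⌉ m : ℕ) : ℝ) ^ s ≤ (V : ℝ) ^ s * ((m : ℝ) ^ (-s) + ((m : ℝ) - 1) / V) := by
  have hm0 : (0 : ℝ) < m := by exact_mod_cast hm
  have hm1 : (1 : ℝ) ≤ m := by exact_mod_cast hm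
  have hV0 : (0 : ℝ) < V := by exact_mod_cast hV
  have hq : 0 ≤ ((m : ℝ) - 1) / V := div_nonneg (by linarith) hV0.le
  have hceil : ((V ⌈/⌉ m : ℕ) : ℝ) ≤ (V : ℝ) * ((m : ℝ)⁻¹ * (1 + ((m : ℝ) - 1) / V)) := by
    have h : (V ⌈/⌉ m) * m ≤ V + m - 1 := by
      rw [Nat.ceilDiv_eq_add_pred_div]
      exact Nat.div_mul_le_self _ _
    have h' : ((V ⌈/⌉ m : ℕ) : ℝ) * m ≤ V + m - 1 := by
      have : (V ⌈/⌉ m) * m + 1 ≤ V + m := by omega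
      have : ((V ⌈/⌉ m : ℕ) : ℝ) * m + 1 ≤ V + m := by exact_mod_cast this
      linarith
    have he : (V : ℝ) * ((m : ℝ)⁻¹ * (1 + ((m : ℝ) - 1) / V)) = (V + m - 1) / m := by
      field_simp
      ring
    rwa [he, le_div_iff₀ hm0]
  have hms : (m : ℝ) ^ (-s) ≤ 1 := Real.rpow_le_one_of_one_le_of_nonpos hm1 (by linarith)
  calc ((V ⌈/⌉ m : ℕ) : ℝ) ^ s ≤ ((V : ℝ) * ((m : ℝ)⁻¹ * (1 + ((m : ℝ) - 1) / V))) ^ s := by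
        gcongr
    _ = (V : ℝ) ^ s * ((m : ℝ) ^ (-s) * (1 + ((m : ℝ) - 1) / V) ^ s) := by
        rw [Real.mul_rpow hV0.le (by positivity), Real.mul_rpow (by positivity) (by positivity),
          Real.inv_rpow hm0.le, Real.rpow_neg hm0.le]
    _ ≤ (V : ℝ) ^ s * ((m : ℝ) ^ (-s) * (1 + ((m : ℝ) - 1) / V)) := by
        gcongr
        refine (rpow_one_add_le_one_add_mul_self (by linarith) hs0 hs1).trans ?_
        nlinarith
    _ ≤ _ := by
        gcongr
        nlinarith

lemma sum_Icc_ceilDiv_rpow_le {d V N : ℕ} (hd : 2 ≤ d) (hV : 1 ≤ V)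
    (hN : N * (N + 1) ^ d < V) :
    ∑ m ∈ Finset.Icc 1 (N + 1), ((V ⌈/⌉ m : ℕ) : ℝ) ^ (((d : ℝ) - 1) / d) ≤
      d * (V : ℝ) ^ ((d : ℝ) / (d + 1)) := by
  have hd2 : (2 : ℝ) ≤ d := by exact_mod_cast hd
  have hV1 : (1 : ℝ) ≤ V := by exact_mod_cast hV
  have hV0 : (0 : ℝ) < V := by linarith
  set p : ℝ := 1 / d with hp
  have hs : ((d : ℝ) - 1) / d = 1 - p := by rw [hp]; field_simp
  have hp0 : 0 < p := by positivity
  have hp2 : p ≤ 1 / 2 := by rw [hp]; gcongr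
  have hdp : d * p = 1 := by rw [hp]; field_simp
  have hexp : 1 - p + p / (d + 1) = (d : ℝ) / (d + 1) := by
    rw [hp]; field_simp; ring
  rw [hs]
  rcases Nat.eq_zero_or_pos N with rfl | hN1
  · have hle : (V : ℝ) ^ (1 - p) ≤ (V : ℝ) ^ ((d : ℝ) / (d + 1)) := by
      refine Real.rpow_le_rpow_of_exponent_le hV1 ?_
      rw [← hexp]
      have : 0 ≤ p / ((d : ℝ) + 1) := by positivity
      linarith
    have : 0 ≤ (V : ℝ) ^ ((d : ℝ) / (d + 1)) := by positivity
    simp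
    nlinarith
  have hN1' : (1 : ℝ) ≤ N := by exact_mod_cast hN1
  have hterm : ∑ m ∈ Finset.Icc 1 (N + 1), ((V ⌈/⌉ m : ℕ) : ℝ) ^ (1 - p) ≤
      (V : ℝ) ^ (1 - p) * (∑ m ∈ Finset.Icc 1 (N + 1), (m : ℝ) ^ (p - 1) +
        ∑ m ∈ Finset.Icc 1 (N + 1), ((m : ℝ) - 1) / V) := by
    rw [← Finset.sum_add_distrib, Finset.mul_sum]
    refine Finset.sum_le_sum fun m hm ↦ ?_
    have := natCast_ceilDiv_rpow_le hV (Finset.mem_Icc.1 hm).1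
      (show 0 ≤ 1 - p by linarith) (by linarith)
    rwa [neg_sub] at this
  have hexcess : ∑ m ∈ Finset.Icc 1 (N + 1), ((m : ℝ) - 1) / V ≤ 1 / 4 := by
    have hgauss : ∀ n : ℕ, ∑ m ∈ Finset.Icc 1 (n + 1), ((m : ℝ) - 1) = n * (n + 1) / 2 := by
      intro n
      induction n with
      | zero => simp
      | succ n ih =>
        rw [Finset.sum_Icc_succ_top (by omega), ih]
        push_cast
        ring
    have h1 : 2 * (N * (N + 1)) ≤ V := by
      have : (N + 1) ^ 2 ≤ (N + 1) ^ d := Nat.pow_le_pow_right (by omega) hd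
      nlinarith
    have h2 : 2 * ((N : ℝ) * (N + 1)) ≤ V := by exact_mod_cast h1
    rw [← Finset.sum_div, hgauss, div_le_iff₀ hV0]
    linarith
  have hlast : ((N + 1 : ℕ) : ℝ) ^ (p - 1) ≤ 3 / 4 := by
    have hM : (2 : ℝ) ≤ (N + 1 : ℕ) := by push_cast; linarith
    calc ((N + 1 : ℕ) : ℝ) ^ (p - 1) ≤ ((N + 1 : ℕ) : ℝ) ^ (-(1 / 2) : ℝ) :=
          Real.rpow_le_rpow_of_exponent_le (by linarith) (by linarith)
      _ = (√((N + 1 : ℕ) : ℝ))⁻¹ := by rw [Real.rpow_neg (by linarith), Real.sqrt_eq_rpow]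
      _ ≤ (4 / 3)⁻¹ := by
          gcongr
          exact Real.le_sqrt_of_sq_le (by norm_num at hM ⊢; linarith)
      _ = 3 / 4 := by norm_num
  have hsum : ∑ m ∈ Finset.Icc 1 N, (m : ℝ) ^ (p - 1) ≤ d * (N : ℝ) ^ p - (d - 1) := by
    have := mul_le_mul_of_nonneg_left
      (mul_sum_Icc_rpow_sub_one_le hp0 (by linarith) hN1) (by linarith : (0 : ℝ) ≤ d)
    rw [← mul_assoc, hdp, one_mul] at this
    refine this.trans_eq ?_
    linear_combination hdp
  have hNV : (N : ℝ) ^ p ≤ (V : ℝ) ^ (p / (d + 1)) := by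
    have h1 : N ^ (d + 1) ≤ V := by
      have : N ^ d ≤ (N + 1) ^ d := Nat.pow_le_pow_left (by omega) d
      rw [pow_succ']
      exact (Nat.mul_le_mul_left N this).trans hN.le
    have h2 : (N : ℝ) ^ (d + 1) ≤ V := by exact_mod_cast h1
    have h3 : (N : ℝ) ^ p = ((N : ℝ) ^ (d + 1)) ^ (p / (d + 1)) := by
      rw [← Real.rpow_natCast, ← Real.rpow_mul (by linarith)]
      congr 1
      push_cast
      field_simp
    rw [h3]
    gcongr
  calc _ ≤ _ := hterm
    _ ≤ (V : ℝ) ^ (1 - p) * (d * (V : ℝ) ^ (p / (d + 1))) := by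
        rw [Finset.sum_Icc_succ_top (by omega)]
        gcongr
        nlinarith
    _ = d * (V : ℝ) ^ ((d : ℝ) / (d + 1)) := by
        rw [← hexp, Real.rpow_add hV0]
        ring

lemma exists_max_sub_one_mul_pow_lt (d : ℕ) {V : ℕ} (hV : 1 ≤ V) :
    ∃ N, N * (N + 1) ^ d < V ∧ ∀ m, 1 ≤ m → (m - 1) * m ^ d < V → m ≤ N + 1 := by
  let P : ℕ → Prop := fun n ↦ n * (n + 1) ^ d < V
  refine ⟨Nat.findGreatest P V, ?_, fun m hm h ↦ ?_⟩
  · exact Nat.findGreatest_spec (P := P) (Nat.zero_le V) (by simp [P]; omega)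
  · have hP : P (m - 1) := by simpa [P, Nat.sub_add_cancel hm] using h
    have hle : m - 1 ≤ V :=
      (Nat.le_mul_of_pos_right _ (Nat.pow_pos hm)).trans h.le
    have := Nat.le_findGreatest (P := P) hle hP
    omega

theorem numMinBoxes_le {d V : ℕ} (hd : 2 ≤ d) (hV : 1 ≤ V) :
    (numMinBoxes d V : ℝ) ≤
      (d.factorial : ℝ) * ((d - 1).factorial : ℝ) * (V : ℝ) ^ (((d : ℝ) - 1) / d) := by
  induction d, hd using Nat.le_induction generalizing V with
  | base =>
    have := numMinBoxes_two_le hV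
    rw [Real.sqrt_eq_rpow] at this
    norm_num [Nat.factorial] at this ⊢
    exact this
  | succ d hd ih =>
    obtain ⟨N, hN, hmax⟩ := exists_max_sub_one_mul_pow_lt d hV
    have hrec : (numMinBoxes (d + 1) V : ℝ) ≤
        (d + 1) * ∑ m ∈ Finset.Icc 1 (N + 1), (numMinBoxes d (V ⌈/⌉ m) : ℝ) := by
      exact_mod_cast numMinBoxes_succ_le d hV hmax
    have hfac : (d.factorial : ℝ) = d * ((d - 1).factorial : ℝ) := by
      exact_mod_cast (Nat.mul_factorial_pred (by omega)).symm
    calc (numMinBoxes (d + 1) V : ℝ) ≤ _ := hrec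
      _ ≤ (d + 1) * ∑ m ∈ Finset.Icc 1 (N + 1),
          (d.factorial : ℝ) * ((d - 1).factorial : ℝ) *
            ((V ⌈/⌉ m : ℕ) : ℝ) ^ (((d : ℝ) - 1) / d) := by
          gcongr with m hm
          exact ih (one_le_ceilDiv hV (Finset.mem_Icc.1 hm).1)
      _ ≤ (d + 1) * ((d.factorial : ℝ) * ((d - 1).factorial : ℝ) *
            (d * (V : ℝ) ^ ((d : ℝ) / (d + 1)))) := by
          rw [← Finset.mul_sum]
          gcongr
          exact sum_Icc_ceilDiv_rpow_le hd hV hN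
      _ = _ := by
          rw [Nat.factorial_succ, Nat.add_sub_cancel]
          push_cast
          rw [add_sub_cancel_right]
          linear_combination (-(d + 1) * (d.factorial : ℝ) * (V : ℝ) ^ ((d : ℝ) / (d + 1))) * hfac

lemma natCeil_sqrt_div_sqrt_le {V : ℕ} (hV : 1 ≤ V) :
    (⌈√(V : ℝ)⌉₊ : ℝ) / √(V : ℝ) ≤ √2 := by
  have hV0 : (0 : ℝ) < V := by exact_mod_cast hV
  have hpos : 0 < √(V : ℝ) := Real.sqrt_pos.2 hV0
  have hn1 : 1 ≤ ⌈√(V : ℝ)⌉₊ := Nat.one_le_ceil_iff.2 hpos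
  have hlt := Nat.ceil_lt_add_one hpos.le
  obtain ⟨k, hk⟩ := Nat.exists_eq_add_of_le' hn1
  rw [hk] at hlt ⊢
  push_cast at hlt
  have hkV : (k : ℝ) ^ 2 < V := (Real.lt_sqrt (Nat.cast_nonneg k)).1 (by linarith)
  have hkV' : k ^ 2 + 1 ≤ V := by exact_mod_cast hkV
  have hkV'' : (k : ℝ) ^ 2 + 1 ≤ V := by exact_mod_cast hkV'
  rw [div_le_iff₀ hpos, ← Real.sqrt_mul zero_le_two]
  refine Real.le_sqrt_of_sq_le ?_
  push_cast
  nlinarith [sq_nonneg ((k : ℝ) - 1)]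

theorem stmt7 (d V : ℕ) (hd : 2 ≤ d) (hV : 1 ≤ V) :
    ((⌈Real.sqrt V⌉₊ : ℝ) / Real.sqrt V ≤ Real.sqrt 2) ∧
    (numMinBoxes d V : ℝ) ≤
      ((⌈Real.sqrt V⌉₊ : ℝ) / Real.sqrt V) ^ (d - 2) * (d.factorial : ℝ) *
        ((d - 1).factorial : ℝ) * (V : ℝ) ^ (((d : ℝ) - 1) / d) ∧
    (numMinBoxes d V : ℝ) ≤
      Real.sqrt 2 ^ (d - 2) * (d.factorial : ℝ) * ((d - 1).factorial : ℝ) *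
        (V : ℝ) ^ (((d : ℝ) - 1) / d) := by
  have hscale {c : ℝ} (hc : 1 ≤ c) : (numMinBoxes d V : ℝ) ≤
      c ^ (d - 2) * (d.factorial : ℝ) * ((d - 1).factorial : ℝ) *
        (V : ℝ) ^ (((d : ℝ) - 1) / d) := by
    refine (numMinBoxes_le hd hV).trans ?_
    rw [mul_assoc (c ^ (d - 2)), mul_assoc (c ^ (d - 2))]
    exact le_mul_of_one_le_left (by positivity) (one_le_pow₀ hc)
  have hpos : 0 < √(V : ℝ) := Real.sqrt_pos.2 (by exact_mod_cast hV)
  exact ⟨natCeil_sqrt_div_sqrt_le hV, hscale ((one_le_div hpos).2 (Nat.le_ceil _)),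
    hscale (Real.one_le_sqrt.2 one_le_two)⟩
end

section
/- Fix d ≥ 1, q ≥ 2, and a > 1, and set V = ⌊a·d·log_q(n)⌋. Then the asymptotic rate of the V-boxes unique arrays approaches 1: lim_{n→∞} log_q|DA_{d,q}(n,V)| / n^d = 1. -/
/-- `W` contains two identical boxes of side lengths `s` at distinct positions
`u, v ∈ ℕ^d`. -/
def identicalBoxesAt (n d q : ℕ) (W : (Fin d → Fin n) → Fin q)
    (u v s : Fin d → ℕ) : Prop :=
  u ≠ v ∧ (∀ i, 1 ≤ s i) ∧ (∀ i, u i + s i ≤ n) ∧ (∀ i, v i + s i ≤ n) ∧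
  ∀ (x y : Fin d → Fin n) (off : Fin d → ℕ), (∀ i, off i < s i) →
    (∀ i, (x i : ℕ) = u i + off i) → (∀ i, (y i : ℕ) = v i + off i) → W x = W y

open Finset in
/-- Colourings in `A`, if determined by their values off `B`, are at most `q ^ (-|B|)` times as
many as those in any family containing all their changes on `B`. -/
theorem card_mul_pow_le_of_determined {X α : Type*} [Fintype X] [DecidableEq X] [Fintype α]
    (B : Finset X) (A G : Finset (X → α))
    (hdet : ∀ W ∈ A, ∀ W' ∈ A, (∀ x ∉ B, W x = W' x) → W = W')
    (hG : ∀ W ∈ A, ∀ W', (∀ x ∉ B, W x = W' x) → W' ∈ G) :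
    #A * Fintype.card α ^ #B ≤ #G := by
  classical
  have hcard : #(A ×ˢ (univ : Finset (B → α))) = #A * Fintype.card α ^ #B := by
    simp [card_product]
  rw [← hcard]
  refine card_le_card_of_injOn
    (fun p x => if h : x ∈ B then p.2 ⟨x, h⟩ else p.1 x) ?_ ?_
  · rintro ⟨W, g⟩ hp
    simp only [coe_product, Set.mem_prod, mem_coe] at hp
    exact hG W hp.1 _ fun x hx => by simp [hx]
  · rintro ⟨W, g⟩ hp ⟨W', g'⟩ hp' h
    simp only [coe_product, Set.mem_prod, mem_coe] at hp hp'
    have hW : W = W' := hdet W hp.1 W' hp'.1 fun x hx => by simpa [hx] using congrFun h x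
    have hg : g = g' := funext fun x => by simpa using congrFun h x
    rw [hW, hg]

open Finset Classical in
/-- The colourings avoiding all events `P i` supported inside `S`. -/
noncomputable def avoiding {X α ι : Type*} [Fintype X] [DecidableEq X] [Fintype α]
    (D : ι → Finset X) (P : ι → (X → α) → Prop) (S : Finset X) : Finset (X → α) :=
  univ.filter fun W => ∀ i, D i ⊆ S → ¬ P i W

theorem mem_avoiding {X α ι : Type*} [Fintype X] [DecidableEq X] [Fintype α]
    {D : ι → Finset X} {P : ι → (X → α) → Prop} {S : Finset X} {W : X → α} :
    W ∈ avoiding D P S ↔ ∀ i, D i ⊆ S → ¬ P i W := by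
  simp [avoiding]

open Finset in
/-- A counting form of the local lemma: if every event meeting a point `x` is determined off a set
of size at least `V` containing `x`, and few events meet `x`, then at least `β ^ |X|` colourings
avoid all events. -/
theorem pow_card_le_card_avoiding {X α ι : Type*} [Fintype X] [DecidableEq X] [Fintype α]
    [Fintype ι] (D : ι → Finset X) (P : ι → (X → α) → Prop) (V N : ℕ) (β : ℝ) (hβ : 1 ≤ β)
    (hβq : β ≤ Fintype.card α)
    (hne : ∀ i W, P i W → (D i).Nonempty)
    (hloc : ∀ i W W', (∀ x ∈ D i, W x = W' x) → P i W → P i W')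
    (hdet : ∀ i W₀, P i W₀ → ∀ x ∈ D i, ∃ B : Finset X, x ∈ B ∧ V ≤ #B ∧
      ∀ W W', P i W → P i W' → (∀ y ∉ B, W y = W' y) → W = W')
    (hN : ∀ x, #{i | x ∈ D i} ≤ N)
    (hNβ : (N : ℝ) * β ≤ (Fintype.card α - β) * β ^ V) :
    β ^ Fintype.card X ≤ #(avoiding D P univ) := by
  classical
  set q : ℝ := (Fintype.card α : ℝ) with hq
  have hq0 : 0 < q := by linarith
  set F : Finset X → ℝ := fun S => (#(avoiding D P S) : ℝ) with hF
  have hγ0 : 0 < β / q := by positivity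
  have hγ1 : β / q ≤ 1 := (div_le_one hq0).2 hβq
  have key : ∀ S T : Finset X, T ⊆ S → (β / q) ^ #(S \ T) * F T ≤ F S := by
    intro S
    induction S using Finset.strongInduction with
    | H S ih =>
    intro T hTS
    rcases hTS.eq_or_ssubset with rfl | hss
    · simp
    obtain ⟨x, hxS, hxT⟩ := exists_of_ssubset hss
    set S' := S.erase x with hS'
    have ih' := ih S' (erase_ssubset hxS)
    have hTS' : T ⊆ S' := subset_erase.2 ⟨hTS, hxT⟩
    have hbad : ∀ i, x ∈ D i →
        (#{W ∈ avoiding D P S' | P i W} : ℝ) * β ^ V ≤ β / q * F S' := by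
      intro i hi
      by_cases hP : ∃ W₀, P i W₀
      swap
      · push Not at hP
        simp only [hP, filter_false, card_empty, Nat.cast_zero, zero_mul]
        positivity
      obtain ⟨W₀, hW₀⟩ := hP
      obtain ⟨B, hxB, hVB, hB⟩ := hdet i W₀ hW₀ x hi
      have h1 : #{W ∈ avoiding D P S' | P i W} * Fintype.card α ^ #B
          ≤ #(avoiding D P (S' \ B)) := by
        refine card_mul_pow_le_of_determined B _ _ ?_ ?_
        · intro W hW W' hW' h
          exact hB W W' (mem_filter.1 hW).2 (mem_filter.1 hW').2 h
        · intro W hW W' h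
          have hW := mem_avoiding.1 (mem_filter.1 hW).1
          refine mem_avoiding.2 fun j hj hPj => hW j (hj.trans sdiff_subset) ?_
          exact hloc j W' W (fun y hy => (h y (mem_sdiff.1 (hj hy)).2).symm) hPj
      have h1' : (#{W ∈ avoiding D P S' | P i W} : ℝ) * q ^ #B ≤ F (S' \ B) := by
        simp only [hF, hq]
        exact_mod_cast h1
      have h2 := ih' (S' \ B) sdiff_subset
      have h3 : #(S' \ (S' \ B)) + 1 ≤ #B := by
        rw [sdiff_sdiff_right_self, Nat.succ_le_iff]
        refine card_lt_card ⟨inf_le_right, fun h => ?_⟩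
        simpa [hS'] using h hxB
      have h4 : (β / q) ^ #B ≤ (β / q) ^ (#(S' \ (S' \ B)) + 1) :=
        pow_le_pow_of_le_one hγ0.le hγ1 h3
      calc (#{W ∈ avoiding D P S' | P i W} : ℝ) * β ^ V
          ≤ (#{W ∈ avoiding D P S' | P i W} : ℝ) * β ^ #B := by gcongr
        _ = (β / q) ^ #B * ((#{W ∈ avoiding D P S' | P i W} : ℝ) * q ^ #B) := by
            rw [div_pow]; field_simp
        _ ≤ (β / q) ^ #B * F (S' \ B) := by gcongr
        _ ≤ (β / q) ^ (#(S' \ (S' \ B)) + 1) * F (S' \ B) := by gcongr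
        _ = β / q * ((β / q) ^ #(S' \ (S' \ B)) * F (S' \ B)) := by ring
        _ ≤ β / q * F S' := by gcongr
    have hcover : avoiding D P S' ⊆ avoiding D P S ∪
        ({i | x ∈ D i} : Finset ι).biUnion fun i => {W ∈ avoiding D P S' | P i W} := by
      intro W hW
      by_cases hWS : W ∈ avoiding D P S
      · exact mem_union_left _ hWS
      · have : ∃ i, D i ⊆ S ∧ P i W := by simpa [mem_avoiding] using hWS
        obtain ⟨i, hiS, hPi⟩ := this
        refine mem_union_right _ (mem_biUnion.2 ⟨i, ?_, mem_filter.2 ⟨hW, hPi⟩⟩)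
        rw [mem_filter]
        refine ⟨mem_univ _, ?_⟩
        by_contra hxi
        exact mem_avoiding.1 hW i (subset_erase.2 ⟨hiS, hxi⟩) hPi
    have hsum : F S' ≤ F S + ∑ i with x ∈ D i, (#{W ∈ avoiding D P S' | P i W} : ℝ) := by
      have := (card_le_card hcover).trans ((card_union_le _ _).trans
        (Nat.add_le_add_left card_biUnion_le _))
      simp only [hF]
      exact_mod_cast this
    set bad := ∑ i with x ∈ D i, (#{W ∈ avoiding D P S' | P i W} : ℝ)
    have hFS' : 0 ≤ F S' := Nat.cast_nonneg _
    have hbadsum : bad * β ^ V ≤ N * (β / q * F S') := by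
      calc bad * β ^ V
          ≤ ∑ i with x ∈ D i, (β / q * F S') := by
            rw [sum_mul]
            exact sum_le_sum fun i hi => hbad i (mem_filter.1 hi).2
        _ = #{i | x ∈ D i} * (β / q * F S') := by rw [sum_const, nsmul_eq_mul]
        _ ≤ N * (β / q * F S') := by
            gcongr
            exact hN x
    have hbadle : bad ≤ (1 - β / q) * F S' := by
      have hV : 0 < β ^ V := by positivity
      refine le_of_mul_le_mul_right ?_ hV
      calc bad * β ^ V ≤ N * (β / q * F S') := hbadsum
        _ = (N * β) * (F S' / q) := by ring
        _ ≤ ((q - β) * β ^ V) * (F S' / q) := by gcongr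
        _ = (1 - β / q) * F S' * β ^ V := by field_simp
    have hstep : β / q * F S' ≤ F S := by linarith
    have hcard : #(S \ T) = #(S' \ T) + 1 := by
      rw [hS', erase_sdiff_comm, card_erase_add_one (mem_sdiff.2 ⟨hxS, hxT⟩)]
    calc (β / q) ^ #(S \ T) * F T = β / q * ((β / q) ^ #(S' \ T) * F T) := by
          rw [hcard]; ring
      _ ≤ β / q * F S' := by gcongr; exact ih' T hTS'
      _ ≤ F S := hstep
  have h0 : F ∅ = q ^ Fintype.card X := by
    have : avoiding D P ∅ = univ := by
      refine eq_univ_of_forall fun W => mem_avoiding.2 fun i hi hPi => ?_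
      exact (hne i W hPi).ne_empty (subset_empty.1 hi)
    simp [hF, this, hq]
  have := key univ ∅ (empty_subset _)
  rw [h0, sdiff_empty, card_univ, div_pow, div_mul_cancel₀ _ (by positivity)] at this
  exact this

theorem identicalBoxesAt.symm {n d q : ℕ} {W : (Fin d → Fin n) → Fin q} {u v s : Fin d → ℕ}
    (h : identicalBoxesAt n d q W u v s) : identicalBoxesAt n d q W v u s := by
  obtain ⟨hne, hs, hu, hv, h⟩ := h
  exact ⟨hne.symm, hs, hv, hu, fun x y off ho hx hy => (h y x off ho hy hx).symm⟩

theorem identicalBoxesAt.mono {n d q : ℕ} {W : (Fin d → Fin n) → Fin q} {u v s t : Fin d → ℕ}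
    (h : identicalBoxesAt n d q W u v s) (ht : ∀ i, 1 ≤ t i) (hts : ∀ i, t i ≤ s i) :
    identicalBoxesAt n d q W u v t := by
  obtain ⟨hne, hs, hu, hv, h⟩ := h
  exact ⟨hne, ht, fun i => (Nat.add_le_add_left (hts i) _).trans (hu i),
    fun i => (Nat.add_le_add_left (hts i) _).trans (hv i),
    fun x y off ho => h x y off fun i => (ho i).trans_le (hts i)⟩

/-- The cells of the box of side lengths `s` at position `u`. -/
def boxCells (n : ℕ) {d : ℕ} (u s : Fin d → ℕ) : Finset (Fin d → Fin n) :=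
  Fintype.piFinset fun i => {x : Fin n | u i ≤ x ∧ (x : ℕ) < u i + s i}

theorem mem_boxCells {n d : ℕ} {u s : Fin d → ℕ} {x : Fin d → Fin n} :
    x ∈ boxCells n u s ↔ ∀ i, u i ≤ x i ∧ (x i : ℕ) < u i + s i := by
  simp [boxCells]

theorem card_boxCells {n d : ℕ} {u s : Fin d → ℕ} (h : ∀ i, u i + s i ≤ n) :
    (boxCells n u s).card = ∏ i, s i := by
  rw [boxCells, Fintype.card_piFinset]
  refine Finset.prod_congr rfl fun i _ => ?_
  rw [← Finset.card_map Fin.valEmbedding]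
  have : (({x : Fin n | u i ≤ x ∧ (x : ℕ) < u i + s i} : Finset (Fin n)).map Fin.valEmbedding)
      = Finset.Ico (u i) (u i + s i) := by
    ext k
    simp only [Finset.mem_map, Finset.mem_filter, Finset.mem_univ, true_and,
      Fin.valEmbedding_apply, Finset.mem_Ico]
    constructor
    · rintro ⟨x, hx, rfl⟩
      exact hx
    · intro hk
      exact ⟨⟨k, hk.2.trans_le (h i)⟩, hk, rfl⟩
  rw [this, Nat.card_Ico, Nat.add_sub_cancel_left]

theorem identicalBoxesAt.exists_shift {n d q : ℕ} {u v s : Fin d → ℕ}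
    (hv : ∀ i, v i + s i ≤ n) {x : Fin d → Fin n} (hx : x ∈ boxCells n u s) :
    ∃ y ∈ boxCells n v s, (∀ i, (y i : ℕ) + u i = x i + v i) ∧
      ∀ W : (Fin d → Fin n) → Fin q, identicalBoxesAt n d q W u v s → W x = W y := by
  rw [mem_boxCells] at hx
  have hy : ∀ i, v i + (x i - u i) < n := fun i => by have := hx i; have := hv i; omega
  refine ⟨fun i => ⟨v i + (x i - u i), hy i⟩, mem_boxCells.2 fun i => ?_, fun i => ?_,
    fun W hW => hW.2.2.2.2 _ _ (fun i => x i - u i) (fun i => ?_) (fun i => ?_) fun i => rfl⟩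
  all_goals have := hx i; lia

/-- Two arrays, each with identical boxes at `u` and `v`, coincide if they agree off the box
at `u`. -/
theorem identicalBoxesAt.eq_of_eqOn_compl {n d q : ℕ} {W W' : (Fin d → Fin n) → Fin q}
    {u v s : Fin d → ℕ} (h : identicalBoxesAt n d q W u v s)
    (h' : identicalBoxesAt n d q W' u v s) (hWW' : ∀ x ∉ boxCells n u s, W x = W' x) :
    W = W' := by
  obtain ⟨i, hi⟩ := Function.ne_iff.1 h.1
  have key : ∀ m : ℕ, ∀ x : Fin d → Fin n,
      (if u i < v i then n - (x i : ℕ) else x i) = m → W x = W' x := by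
    intro m
    induction m using Nat.strong_induction_on with
    | _ m ih =>
    intro x hm
    by_cases hx : x ∈ boxCells n u s
    · obtain ⟨y, -, hyx, hy⟩ := identicalBoxesAt.exists_shift (q := q) h.2.2.2.1 hx
      rw [hy W h, hy W' h']
      refine ih _ ?_ y rfl
      have := hyx i
      have := (x i).2
      have := (y i).2
      subst hm
      split_ifs <;> omega
    · exact hWW' x hx
  exact funext fun x => key _ x rfl

theorem le_prod_min {d V : ℕ} {s : Fin d → ℕ} (hV : 1 ≤ V) (hs : ∀ i, 1 ≤ s i)
    (h : V ≤ ∏ i, s i) : V ≤ ∏ i, min (s i) V := by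
  by_cases hall : ∀ i, s i ≤ V
  · simpa [min_eq_left (hall _)] using h
  · push Not at hall
    obtain ⟨i, hi⟩ := hall
    calc V = min (s i) V := (min_eq_right hi.le).symm
      _ ≤ ∏ i, min (s i) V := Finset.single_le_prod' (f := fun i => min (s i) V)
          (fun j _ => le_min (hs j) hV) (Finset.mem_univ i)

open Finset in
theorem card_filter_mem_boxCells_le {n d : ℕ} (V : ℕ) (x : Fin d → Fin n) :
    #{p : (Fin d → Fin n) × (Fin d → Fin (V + 1)) |
      x ∈ boxCells n (fun i => (p.1 i : ℕ)) (fun i => (p.2 i : ℕ))} ≤ (V + 1) ^ (2 * d) := by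
  have hsub : ({p : (Fin d → Fin n) × (Fin d → Fin (V + 1)) |
      x ∈ boxCells n (fun i => (p.1 i : ℕ)) (fun i => (p.2 i : ℕ))} : Finset _) ⊆
      (Fintype.piFinset fun i => ({u : Fin n | (u : ℕ) ∈ Icc (x i - V : ℕ) (x i)} : Finset (Fin n)))
        ×ˢ univ := by
    rintro ⟨u, s⟩ hp
    simp only [mem_filter, mem_univ, true_and, mem_boxCells] at hp
    simp only [mem_product, Fintype.mem_piFinset, mem_filter, mem_univ, true_and, and_true,
      mem_Icc]
    intro i
    have := hp i
    have := (s i).2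
    omega
  refine (card_le_card hsub).trans ?_
  rw [card_product, Fintype.card_piFinset, card_univ, Fintype.card_pi_const, Fintype.card_fin,
    two_mul, pow_add]
  refine Nat.mul_le_mul_right _ ?_
  calc ∏ i, #{u : Fin n | (u : ℕ) ∈ Icc (x i - V : ℕ) (x i)}
      ≤ ∏ _i : Fin d, (V + 1) := by
        refine prod_le_prod' fun i _ => ?_
        rw [← card_map Fin.valEmbedding]
        refine (card_le_card (t := Icc (x i - V : ℕ) (x i)) ?_).trans ?_
        · intro k hk
          obtain ⟨u, hu, rfl⟩ := mem_map.1 hk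
          exact (mem_filter.1 hu).2
        · rw [Nat.card_Icc]; omega
    _ = (V + 1) ^ d := by simp

open Finset in
/-- The number of arrays without identical boxes of volume at least `V` is at least `β ^ (n ^ d)`
as soon as `β < q` is small enough compared to `V`. -/
theorem pow_le_card_boxes_unique {n d q V : ℕ} (hV : 1 ≤ V) {β : ℝ} (hβ : 1 ≤ β) (hβq : β ≤ q)
    (h : ((2 * (n ^ d * (V + 1) ^ (2 * d)) : ℕ) : ℝ) * β ≤ (q - β) * β ^ V) :
    β ^ (n ^ d) ≤ Nat.card {W : (Fin d → Fin n) → Fin q //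
      ∀ u v s : Fin d → ℕ, V ≤ ∏ i, s i → ¬ identicalBoxesAt n d q W u v s} := by
  classical
  let ι := (Fin d → Fin n) × (Fin d → Fin n) × (Fin d → Fin (V + 1))
  let box : (Fin d → Fin n) → (Fin d → Fin (V + 1)) → Finset (Fin d → Fin n) :=
    fun u s => boxCells n (fun i => (u i : ℕ)) (fun i => (s i : ℕ))
  let D : ι → Finset (Fin d → Fin n) := fun p => box p.1 p.2.2 ∪ box p.2.1 p.2.2
  let P : ι → ((Fin d → Fin n) → Fin q) → Prop := fun p W =>
    V ≤ ∏ i, (p.2.2 i : ℕ) ∧ identicalBoxesAt n d q W (fun i => (p.1 i : ℕ))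
      (fun i => (p.2.1 i : ℕ)) (fun i => (p.2.2 i : ℕ))
  have hcardX : Fintype.card (Fin d → Fin n) = n ^ d := by simp
  have main := pow_card_le_card_avoiding D P V (2 * (n ^ d * (V + 1) ^ (2 * d))) β hβ
    (by simpa using hβq) ?_ ?_ ?_ ?_ (by simpa using h)
  · rw [hcardX] at main
    refine main.trans ?_
    rw [Nat.card_eq_fintype_card, Fintype.card_subtype]
    refine Nat.cast_le.2 (card_le_card fun W hW => mem_filter.2 ⟨mem_univ _, ?_⟩)
    intro u v s hVs hid
    have hlt : ∀ w : Fin d → ℕ, (∀ i, w i + s i ≤ n) → ∀ i, w i < n := fun w hw i => by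
      have := hw i; have := hid.2.1 i; omega
    refine mem_avoiding.1 hW (fun i => ⟨u i, hlt u hid.2.2.1 i⟩,
      fun i => ⟨v i, hlt v hid.2.2.2.1 i⟩,
      fun i => ⟨min (s i) V, Nat.lt_succ_of_le (min_le_right _ _)⟩) (subset_univ _) ?_
    exact ⟨le_prod_min hV hid.2.1 hVs,
      hid.mono (fun i => le_min (hid.2.1 i) hV) fun i => min_le_left _ _⟩
  · rintro ⟨u, v, s⟩ W ⟨hVs, hW⟩
    refine (card_pos.1 ?_).mono subset_union_left
    exact hV.trans (hVs.trans (card_boxCells hW.2.2.1).ge)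
  · rintro ⟨u, v, s⟩ W W' hWW' ⟨hVs, hne, hs, hu, hv, hW⟩
    refine ⟨hVs, hne, hs, hu, hv, fun x y off ho hx hy => ?_⟩
    rw [← hWW' x, ← hWW' y]
    · exact hW x y off ho hx hy
    · refine mem_union_right _ (mem_boxCells.2 fun i => ?_)
      have := ho i; have := hy i; simp only at *; omega
    · refine mem_union_left _ (mem_boxCells.2 fun i => ?_)
      have := ho i; have := hx i; simp only at *; omega
  · rintro ⟨u, v, s⟩ W₀ ⟨hVs, hW₀⟩ x hx
    rcases mem_union.1 hx with hx | hx
    · exact ⟨_, hx, hVs.trans (card_boxCells hW₀.2.2.1).ge,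
        fun W W' hW hW' => hW.2.eq_of_eqOn_compl hW'.2⟩
    · exact ⟨_, hx, hVs.trans (card_boxCells hW₀.2.2.2.1).ge,
        fun W W' hW hW' => hW.2.symm.eq_of_eqOn_compl hW'.2.symm⟩
  · intro x
    let R : Finset ((Fin d → Fin n) × (Fin d → Fin (V + 1))) := {p | x ∈ box p.1 p.2}
    have hR : #R ≤ (V + 1) ^ (2 * d) := card_filter_mem_boxCells_le V x
    have hprod : #((univ : Finset (Fin d → Fin n)) ×ˢ R) ≤ n ^ d * (V + 1) ^ (2 * d) := by
      rw [card_product, card_univ, hcardX]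
      exact Nat.mul_le_mul_left _ hR
    have hsub : ({p : ι | x ∈ D p} : Finset ι) ⊆
        ((univ : Finset (Fin d → Fin n)) ×ˢ R).image (fun p => (p.2.1, p.1, p.2.2)) ∪
        ((univ : Finset (Fin d → Fin n)) ×ˢ R) := by
      rintro ⟨u, v, s⟩ hp
      rcases mem_union.1 (mem_filter.1 hp).2 with hx | hx
      · exact mem_union_left _ (mem_image.2 ⟨(v, u, s),
          mem_product.2 ⟨mem_univ _, mem_filter.2 ⟨mem_univ _, hx⟩⟩, rfl⟩)
      · exact mem_union_right _
          (mem_product.2 ⟨mem_univ _, mem_filter.2 ⟨mem_univ _, hx⟩⟩)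
    calc #{p : ι | x ∈ D p} ≤ _ := card_le_card hsub
      _ ≤ _ := card_union_le _ _
      _ ≤ n ^ d * (V + 1) ^ (2 * d) + n ^ d * (V + 1) ^ (2 * d) :=
        Nat.add_le_add (card_image_le.trans hprod) hprod
      _ = 2 * (n ^ d * (V + 1) ^ (2 * d)) := by ring

open Filter in
theorem tendsto_floor_mul_logb_atTop {q : ℕ} (hq : 2 ≤ q) {c : ℝ} (hc : 0 < c) :
    Tendsto (fun n : ℕ => ⌊c * Real.logb q n⌋₊) atTop atTop :=
  tendsto_nat_floor_atTop.comp <| (Tendsto.const_mul_atTop hc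
    (Real.tendsto_logb_atTop (by exact_mod_cast hq))).comp tendsto_natCast_atTop_atTop

theorem pow_le_rpow_floor {q d n : ℕ} (hq : 2 ≤ q) {a : ℝ} (ha : 0 < a) (hn : 0 < n) :
    (n : ℝ) ^ d ≤ ((q : ℝ) ^ (1 / a)) ^ (⌊a * d * Real.logb q n⌋₊ + 1) := by
  have hq1 : (1 : ℝ) < q := by exact_mod_cast hq
  have hn' : (0 : ℝ) < n := by exact_mod_cast hn
  calc (n : ℝ) ^ d = (q : ℝ) ^ (Real.logb q n * d) := by
        rw [Real.rpow_mul (by positivity), Real.rpow_logb (by positivity) hq1.ne' hn',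
          Real.rpow_natCast]
    _ ≤ (q : ℝ) ^ (1 / a * ((⌊a * d * Real.logb q n⌋₊ + 1 : ℕ) : ℝ)) := by
        refine Real.rpow_le_rpow_of_exponent_le hq1.le ?_
        have := (Nat.lt_floor_add_one (a * d * Real.logb q n)).le
        rw [one_div, inv_mul_eq_div, le_div_iff₀ ha]
        push_cast
        linarith
    _ = _ := by rw [Real.rpow_mul (by positivity), Real.rpow_natCast]

open Filter Topology in
theorem eventually_count_mul_le {q d : ℕ} (hq : 2 ≤ q) (hd : 1 ≤ d) {a β : ℝ} (ha : 0 < a)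
    (hβ : (q : ℝ) ^ (1 / a) < β) (hβq : β < q) :
    ∀ᶠ n : ℕ in atTop,
      ((2 * (n ^ d * (⌊a * d * Real.logb q n⌋₊ + 1) ^ (2 * d)) : ℕ) : ℝ) * β
        ≤ (q - β) * β ^ ⌊a * d * Real.logb q n⌋₊ := by
  have hρ0 : 0 < (q : ℝ) ^ (1 / a) := by positivity
  have hβ0 : 0 < β := hρ0.trans hβ
  set ρ : ℝ := (q : ℝ) ^ (1 / a) with hρ
  have hd0 : (0 : ℝ) < d := by exact_mod_cast hd
  have hV := tendsto_floor_mul_logb_atTop hq (mul_pos ha hd0)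
  have hlim : Tendsto (fun k : ℕ => (k : ℝ) ^ (2 * d) * (ρ / β) ^ k) atTop (𝓝 0) :=
    tendsto_pow_const_mul_const_pow_of_abs_lt_one _ (by
      rw [abs_of_pos (by positivity), div_lt_one hβ0]; exact hβ)
  have hlim' := (hlim.comp ((tendsto_add_atTop_nat 1).comp hV)).eventually
    (gt_mem_nhds (show 0 < (q - β) / (2 * β ^ 2) by
      have : 0 < q - β := sub_pos.2 hβq
      positivity))
  filter_upwards [hlim', eventually_gt_atTop 0] with n hn hn0
  have hpow := pow_le_rpow_floor (d := d) hq ha hn0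
  rw [← hρ] at hpow
  simp only [Function.comp_apply] at hn
  set V := ⌊a * d * Real.logb q n⌋₊
  rw [lt_div_iff₀ (by positivity), div_pow] at hn
  push_cast at hn ⊢
  calc 2 * ((n : ℝ) ^ d * ((V : ℝ) + 1) ^ (2 * d)) * β
      ≤ 2 * (ρ ^ (V + 1) * ((V : ℝ) + 1) ^ (2 * d)) * β := by gcongr
    _ = (((V : ℝ) + 1) ^ (2 * d) * (ρ ^ (V + 1) / β ^ (V + 1)) * (2 * β ^ 2)) * β ^ V := by
        field_simp
        ring
    _ ≤ (q - β) * β ^ V := by gcongr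

theorem stmt13 (q d : ℕ) (hq : 2 ≤ q) (hd : 1 ≤ d) (a : ℝ) (ha : 1 < a) :
    Filter.Tendsto
      (fun n : ℕ =>
        Real.logb q
            (Nat.card {W : (Fin d → Fin n) → Fin q //
              ∀ u v s : Fin d → ℕ,
                ⌊a * (d : ℝ) * Real.logb q n⌋₊ ≤ ∏ i, s i →
                  ¬ identicalBoxesAt n d q W u v s}) / (n : ℝ) ^ d)
      Filter.atTop (nhds 1) := by
  have hq1 : (1 : ℝ) < q := by exact_mod_cast hq
  have ha0 : 0 < a := by linarith
  have hd0 : (0 : ℝ) < d := by exact_mod_cast hd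
  refine tendsto_order.2 ⟨fun δ hδ => ?_, fun δ hδ => ?_⟩
  · obtain ⟨t, ht, ht1⟩ := exists_between (max_lt hδ ((div_lt_one ha0).2 ha))
    obtain ⟨hδt, hat⟩ := max_lt_iff.1 ht
    have ht0 : 0 < t := (one_div_pos.2 ha0).trans hat
    have hβ : (q : ℝ) ^ (1 / a) < (q : ℝ) ^ t := Real.rpow_lt_rpow_of_exponent_lt hq1 hat
    have hβq : (q : ℝ) ^ t < q := by
      simpa using Real.rpow_lt_rpow_of_exponent_lt hq1 ht1
    have hV := (tendsto_floor_mul_logb_atTop hq (mul_pos ha0 hd0)).eventually_ge_atTop 1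
    filter_upwards [eventually_count_mul_le hq hd ha0 hβ hβq, hV,
      Filter.eventually_gt_atTop 0] with n hn hVn hn0
    have hcard := pow_le_card_boxes_unique hVn (Real.one_le_rpow hq1.le ht0.le) hβq.le hn
    refine hδt.trans_le ?_
    rw [le_div_iff₀ (by positivity)]
    calc t * (n : ℝ) ^ d = Real.logb q (((q : ℝ) ^ t) ^ (n ^ d)) := by
          rw [Real.logb_pow, Real.logb_rpow (by positivity) hq1.ne']
          push_cast
          ring
      _ ≤ _ := Real.logb_le_logb_of_le hq1 (by positivity) hcard
  · filter_upwards [Filter.eventually_gt_atTop 0] with n hn0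
    refine lt_of_le_of_lt (div_le_one_of_le₀ ?_ (by positivity)) hδ
    set c := Nat.card {W : (Fin d → Fin n) → Fin q //
      ∀ u v s : Fin d → ℕ, ⌊a * (d : ℝ) * Real.logb q n⌋₊ ≤ ∏ i, s i →
        ¬ identicalBoxesAt n d q W u v s}
    have hc : c ≤ q ^ (n ^ d) := by
      refine (Finite.card_subtype_le _).trans_eq ?_
      simp
    rcases Nat.eq_zero_or_pos c with hc0 | hc0
    · rw [hc0, Nat.cast_zero, Real.logb_zero]
      positivity
    · calc Real.logb q c ≤ Real.logb q ((q : ℝ) ^ (n ^ d)) :=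
            Real.logb_le_logb_of_le hq1 (by exact_mod_cast hc0) (by exact_mod_cast hc)
        _ = (n : ℝ) ^ d := by
          rw [Real.logb_pow, Real.logb_self_eq_one hq1]
          push_cast
          ring
end

section
/- There exists a constant C_1 > 0 (depending on q) such that for all positive integers n and all L ≥ 3, the redundancy of the set of zero L-squares free n×n arrays over Σ_q satisfies red(C_{2,q}(n,L)) ≤ C_1 · n² / q^{L²}. -/
/-- The `n × n` array `W` contains an all-zero `L × L` subsquare at position `(u, v)`. -/
def zeroSquareAt (n L q : ℕ) (W : Fin n → Fin n → Fin q) (u v : ℕ) : Prop :=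
  u + L ≤ n ∧ v + L ≤ n ∧
  ∀ a b : Fin n,
    (u ≤ (a : ℕ) ∧ (a : ℕ) < u + L ∧ v ≤ (b : ℕ) ∧ (b : ℕ) < v + L) → (W a b : ℕ) = 0

/-- Containing a zero square at a given position is a decreasing property of the array. -/
theorem zeroSquareAt.anti {n L q u v : ℕ} {W W' : Fin n → Fin n → Fin q} (h : W ≤ W')
    (hW' : zeroSquareAt n L q W' u v) : zeroSquareAt n L q W u v := by
  refine ⟨hW'.1, hW'.2.1, fun a b hab => ?_⟩
  have h₁ : (W a b : ℕ) ≤ W' a b := h a b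
  have h₂ := hW'.2.2 a b hab
  omega

/-- At most a fraction `q ^ (-L ^ 2)` of all arrays have a zero square at a given position. -/
theorem card_zeroSquareAt_mul_le (n L q u v : ℕ) :
    Nat.card {W : Fin n → Fin n → Fin q // zeroSquareAt n L q W u v} * q ^ (L ^ 2) ≤
      Nat.card (Fin n → Fin n → Fin q) := by
  have hF : Nat.card (Fin L → Fin L → Fin q) = q ^ (L ^ 2) := by
    simp [← pow_mul, sq]
  rw [← hF, ← Nat.card_prod]
  let φ : {W : Fin n → Fin n → Fin q // zeroSquareAt n L q W u v} × (Fin L → Fin L → Fin q) →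
      (Fin n → Fin n → Fin q) := fun x a b =>
    if h : (u ≤ (a : ℕ) ∧ (a : ℕ) < u + L) ∧ v ≤ (b : ℕ) ∧ (b : ℕ) < v + L then
      x.2 ⟨a - u, by omega⟩ ⟨b - v, by omega⟩
    else x.1.1 a b
  refine Nat.card_le_card_of_injective φ ?_
  rintro ⟨⟨W, hu, hv, hW⟩, F⟩ ⟨⟨W', _, _, hW'⟩, F'⟩ h
  have key (a b) := congrFun (congrFun h a) b
  simp only [φ] at key
  refine Prod.ext (Subtype.ext ?_) ?_
  · funext a b
    by_cases hab : (u ≤ (a : ℕ) ∧ (a : ℕ) < u + L) ∧ v ≤ (b : ℕ) ∧ (b : ℕ) < v + L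
    · exact Fin.ext ((hW a b (by tauto)).trans (hW' a b (by tauto)).symm)
    · simpa [hab] using key a b
  · funext i j
    have hij := key ⟨u + i, by omega⟩ ⟨v + j, by omega⟩
    simpa using hij

open Classical in
/-- By the FKG inequality, the events of avoiding zero squares at given positions are
positively correlated. -/
theorem pow_card_mul_le_card_avoiding {n L q : ℕ} (hq : 0 < q) (A : Finset (ℕ × ℕ)) :
    (1 - ((q : ℝ) ^ (L ^ 2))⁻¹) ^ A.card * (q : ℝ) ^ (n ^ 2) ≤
      Nat.card {W : Fin n → Fin n → Fin q // ∀ s ∈ A, ¬ zeroSquareAt n L q W s.1 s.2} := by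
  have hα : (Nat.card (Fin n → Fin n → Fin q) : ℝ) = (q : ℝ) ^ (n ^ 2) := by
    simp [← pow_mul, sq]
  have hqL : (1 : ℝ) ≤ (q : ℝ) ^ (L ^ 2) := one_le_pow₀ (by exact_mod_cast hq)
  have hp : 0 ≤ 1 - ((q : ℝ) ^ (L ^ 2))⁻¹ := sub_nonneg.2 (inv_le_one_of_one_le₀ hqL)
  have hqn : 0 < (q : ℝ) ^ (n ^ 2) := by positivity
  induction A using Finset.induction_on with
  | empty => simp [← pow_mul, sq]
  | insert s A hs ih =>
    let f : (Fin n → Fin n → Fin q) → ℝ := fun W =>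
      if ∀ s ∈ A, ¬ zeroSquareAt n L q W s.1 s.2 then 1 else 0
    let g : (Fin n → Fin n → Fin q) → ℝ := fun W =>
      if ¬ zeroSquareAt n L q W s.1 s.2 then 1 else 0
    have hf : Monotone f := by
      intro W W' h
      simp only [f]
      split_ifs with h₁ h₂
      · exact le_rfl
      · exact absurd (fun s hs hW' => h₁ s hs (hW'.anti h)) h₂
      · exact zero_le_one
      · exact le_rfl
    have hg : Monotone g := by
      intro W W' h
      simp only [g]
      split_ifs with h₁ h₂
      · exact le_rfl
      · exact zero_le_one
      · exact absurd (zeroSquareAt.anti h ‹_›) h₁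
      · exact le_rfl
    have hcorr := fkg (μ := fun _ => (1 : ℝ)) (f := f) (g := g) (fun _ => zero_le_one)
      (fun W => by simp only [f, Pi.zero_apply]; positivity)
      (fun W => by simp only [g, Pi.zero_apply]; positivity) hf hg (by simp)
    have hfsum : ∑ W, f W =
        Nat.card {W : Fin n → Fin n → Fin q // ∀ s ∈ A, ¬ zeroSquareAt n L q W s.1 s.2} := by
      simp only [f]
      rw [Finset.sum_boole, Nat.card_eq_fintype_card, Fintype.card_subtype]
    have hgsum : ∑ W, g W = (q : ℝ) ^ (n ^ 2) -
        Nat.card {W : Fin n → Fin n → Fin q // zeroSquareAt n L q W s.1 s.2} := by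
      rw [← hα, eq_sub_iff_add_eq, Nat.card_eq_fintype_card, Nat.card_eq_fintype_card]
      simp only [g]
      rw [Finset.sum_boole, Fintype.card_subtype, add_comm, ← Nat.cast_add,
        Finset.card_filter_add_card_filter_not, Finset.card_univ]
    have hfgsum : ∑ W, f W * g W = Nat.card {W : Fin n → Fin n → Fin q //
        ∀ t ∈ insert s A, ¬ zeroSquareAt n L q W t.1 t.2} := by
      rw [Nat.card_eq_fintype_card, Fintype.card_subtype, ← Finset.sum_boole]
      refine Finset.sum_congr rfl fun W _ => ?_
      simp only [f, g, Finset.forall_mem_insert, ← ite_and, mul_ite, mul_one, mul_zero]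
    have hsum : ∑ _W : Fin n → Fin n → Fin q, (1 : ℝ) = (q : ℝ) ^ (n ^ 2) := by
      rw [← hα]; simp
    simp only [one_mul] at hcorr
    rw [hfsum, hgsum, hfgsum, hsum] at hcorr
    have hcard : (Nat.card {W : Fin n → Fin n → Fin q // zeroSquareAt n L q W s.1 s.2} : ℝ) ≤
        (q : ℝ) ^ (n ^ 2) * ((q : ℝ) ^ (L ^ 2))⁻¹ := by
      rw [← div_eq_mul_inv, le_div_iff₀ (by positivity), ← hα]
      exact_mod_cast card_zeroSquareAt_mul_le n L q s.1 s.2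
    rw [Finset.card_insert_of_notMem hs, pow_succ]
    refine le_of_mul_le_mul_left (le_trans ?_ hcorr) hqn
    calc (q : ℝ) ^ (n ^ 2) * ((1 - ((q : ℝ) ^ (L ^ 2))⁻¹) ^ A.card *
            (1 - ((q : ℝ) ^ (L ^ 2))⁻¹) * (q : ℝ) ^ (n ^ 2))
        = ((1 - ((q : ℝ) ^ (L ^ 2))⁻¹) ^ A.card * (q : ℝ) ^ (n ^ 2)) *
            ((q : ℝ) ^ (n ^ 2) - (q : ℝ) ^ (n ^ 2) * ((q : ℝ) ^ (L ^ 2))⁻¹) := by ring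
      _ ≤ _ := by
        refine mul_le_mul ih (by linarith) ?_ (Nat.cast_nonneg _)
        rw [← mul_one_sub]
        positivity

theorem stmt15 (q : ℕ) (hq : 2 ≤ q) :
    ∃ C₁ : ℝ, 0 < C₁ ∧ ∀ n L : ℕ, 1 ≤ n → 3 ≤ L →
      (n : ℝ) ^ 2 -
          Real.logb q
            (Nat.card {W : Fin n → Fin n → Fin q // ∀ u v : ℕ, ¬ zeroSquareAt n L q W u v})
        ≤ C₁ * (n : ℝ) ^ 2 / (q : ℝ) ^ (L ^ 2) := by
  have hq1 : (2 : ℝ) ≤ q := by exact_mod_cast hq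
  have hlog : 0 < Real.log q := Real.log_pos (by linarith)
  refine ⟨2 / Real.log q, by positivity, fun n L _ hL => ?_⟩
  have hcount := pow_card_mul_le_card_avoiding (n := n) (L := L) (by omega : 0 < q)
    (Finset.range n ×ˢ Finset.range n)
  have hset (W : Fin n → Fin n → Fin q) :
      (∀ s ∈ Finset.range n ×ˢ Finset.range n, ¬ zeroSquareAt n L q W s.1 s.2) ↔
        ∀ u v : ℕ, ¬ zeroSquareAt n L q W u v := by
    refine ⟨fun h u v hW => h (u, v) ?_ hW, fun h s _ => h s.1 s.2⟩
    obtain ⟨hu, hv, -⟩ := hW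
    simp only [Finset.mem_product, Finset.mem_range]
    omega
  simp only [hset, Finset.card_product, Finset.card_range, ← sq] at hcount
  have hqL : (2 : ℝ) ≤ (q : ℝ) ^ (L ^ 2) :=
    hq1.trans (le_self_pow₀ (by linarith) (by positivity))
  set p : ℝ := ((q : ℝ) ^ (L ^ 2))⁻¹ with hp
  have hp0 : 0 < p := by positivity
  have hp2 : p ≤ 1 / 2 := by
    rw [hp, one_div]
    exact inv_anti₀ two_pos hqL
  have h1p : 0 < 1 - p := by linarith
  have hlogcount := Real.log_le_log (by positivity) hcount
  rw [Real.log_mul (by positivity) (by positivity), Real.log_pow, Real.log_pow] at hlogcount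
  have hlog1p : -(2 * p) ≤ Real.log (1 - p) := by
    refine le_trans ?_ (Real.one_sub_inv_le_log_of_pos h1p)
    have : (1 - p)⁻¹ ≤ 1 + 2 * p := by
      rw [inv_le_iff_one_le_mul₀ h1p]
      nlinarith
    linarith
  push_cast at hlogcount
  rw [Real.logb, mul_div_assoc, div_eq_mul_inv _ ((q : ℝ) ^ (L ^ 2)), ← hp, sub_le_iff_le_add,
    div_mul_eq_mul_div, ← add_div, le_div_iff₀ hlog]
  nlinarith [mul_le_mul_of_nonneg_left hlog1p (sq_nonneg (n : ℝ))]
end
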